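/- Let H be a Hermitian n×n complex matrix, A an n×n complex matrix, σ > 0, and let Â(ω) := Σ_{ν∈B(H)} A_ν f̂(ω−ν) be the operator Fourier transform of A, where A_ν := Σ_{E₂−E₁=ν} P_{E₂} A P_{E₁} (P_E the eigenprojections of H, B(H) the set of eigenvalue differences) and f̂(ω) = (σ√(2π))^{−1/2} exp(−ω²/(4σ²)). Then for all real β and ω: ‖Â(ω)‖ ≤ (e^{−βω + σ²β²}/√(σ√(2π))) · ‖exp(βH) A exp(−βH)‖, where ‖·‖ is the operator (spectral) norm. -/

import Mathlib

open MeasureTheory Matrix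
open scoped Classical

noncomputable section

variable {n : ℕ}

/-- The orthogonal projection `P_E` onto the `E`-eigenspace of a Hermitian matrix `H`. -/
def eigenspaceProj {H : Matrix (Fin n) (Fin n) ℂ} (hH : H.IsHermitian) (E : ℝ) :
    Matrix (Fin n) (Fin n) ℂ :=
  ∑ i ∈ Finset.univ.filter (fun i => hH.eigenvalues i = E),
    (hH.eigenvectorUnitary : Matrix (Fin n) (Fin n) ℂ) * Matrix.single i i 1 *
      (star (hH.eigenvectorUnitary : Matrix (Fin n) (Fin n) ℂ))

/-- The finite set of eigenvalues of a Hermitian matrix `H`. -/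
def eigenvalueSet {H : Matrix (Fin n) (Fin n) ℂ} (hH : H.IsHermitian) : Finset ℝ :=
  Finset.univ.image hH.eigenvalues

/-- The finite set `B(H)` of Bohr frequencies (differences of eigenvalues) of `H`. -/
def bohrSet {H : Matrix (Fin n) (Fin n) ℂ} (hH : H.IsHermitian) : Finset ℝ :=
  (eigenvalueSet hH ×ˢ eigenvalueSet hH).image (fun p => p.2 - p.1)

/-- `A_ν := Σ_{(E₁,E₂): E₂−E₁=ν} P_{E₂} A P_{E₁}`, the component of `A` changing the energy
of `H` by exactly `ν`. -/
def bohrComponent {H : Matrix (Fin n) (Fin n) ℂ} (hH : H.IsHermitian)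
    (A : Matrix (Fin n) (Fin n) ℂ) (ν : ℝ) : Matrix (Fin n) (Fin n) ℂ :=
  ∑ p ∈ (eigenvalueSet hH ×ˢ eigenvalueSet hH).filter (fun p => p.2 - p.1 = ν),
    eigenspaceProj hH p.2 * A * eigenspaceProj hH p.1

/-- The Gaussian weight `f̂(ω) = (σ√(2π))^{−1/2} exp(−ω²/(4σ²))`. -/
def gaussianWeight (σ ω : ℝ) : ℝ :=
  (Real.sqrt (σ * Real.sqrt (2 * Real.pi)))⁻¹ * Real.exp (-ω ^ 2 / (4 * σ ^ 2))

/-- The operator Fourier transform `Â(ω) := Σ_{ν ∈ B(H)} A_ν f̂(ω−ν)`. -/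
def oft {H : Matrix (Fin n) (Fin n) ℂ} (hH : H.IsHermitian)
    (A : Matrix (Fin n) (Fin n) ℂ) (σ ω : ℝ) : Matrix (Fin n) (Fin n) ℂ :=
  ∑ ν ∈ bohrSet hH, (gaussianWeight σ (ω - ν) : ℂ) • bohrComponent hH A ν

end

open scoped Matrix.Norms.L2Operator

/-- Schur multiplication by translates of a characteristic function, evaluated at the differences
of a real sequence, is a contraction for the spectral norm. -/
theorem norm_charFun_schur_le {m : Type*} [Fintype m] [DecidableEq m]
    (P : Measure ℝ) [IsProbabilityMeasure P] (l : m → ℝ) (s : ℝ) (N : Matrix m m ℂ) :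
    ‖Matrix.of fun i j => charFun P (s - (l i - l j)) * N i j‖ ≤ ‖N‖ := by
  let F : ℝ → Matrix m m ℂ := fun t =>
    Complex.exp ((s * t : ℝ) * Complex.I) •
      (diagonal (fun i => Complex.exp ((-(l i * t) : ℝ) * Complex.I)) * N *
        diagonal (fun i => Complex.exp ((l i * t : ℝ) * Complex.I)))
  have hdiag : ∀ r : m → ℝ, ‖diagonal fun i => Complex.exp ((r i : ℝ) * Complex.I)‖ ≤ 1 := by
    intro r
    rw [l2_opNorm_diagonal]
    refine (pi_norm_le_iff_of_nonneg zero_le_one).2 fun i => ?_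
    rw [Complex.norm_exp_ofReal_mul_I]
  have hnorm : ∀ t, ‖F t‖ ≤ ‖N‖ := by
    intro t
    simp only [F]
    rw [norm_smul, Complex.norm_exp_ofReal_mul_I, one_mul]
    calc _ ≤ 1 * ‖N‖ * 1 := by
          refine (norm_mul_le _ _).trans ?_
          gcongr
          · refine (norm_mul_le _ _).trans ?_
            gcongr
            exact hdiag _
          · exact hdiag _
      _ = ‖N‖ := by ring
  have hcont : Continuous F := by
    have hphase : ∀ r : m → ℝ,
        Continuous fun t : ℝ => diagonal fun i => Complex.exp ((r i * t : ℝ) * Complex.I) :=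
      fun r => Continuous.matrix_diagonal (by fun_prop)
    have hphase' := hphase fun i => -l i
    simp only [neg_mul] at hphase'
    have hscalar : Continuous fun t : ℝ => Complex.exp ((s * t : ℝ) * Complex.I) := by fun_prop
    exact hscalar.smul ((hphase'.mul continuous_const).mul (hphase l))
  have hint : Integrable F P :=
    Integrable.of_bound hcont.aestronglyMeasurable ‖N‖ (.of_forall hnorm)
  have hF : (Matrix.of fun i j => charFun P (s - (l i - l j)) * N i j) = ∫ t, F t ∂P := by
    ext i j
    have hentry := ((Matrix.entryLinearMap ℂ ℂ i j).toContinuousLinearMap).integral_comp_comm hint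
    simp only [LinearMap.coe_toContinuousLinearMap', Matrix.entryLinearMap_apply] at hentry
    rw [← hentry, Matrix.of_apply, charFun_apply_real, ← integral_mul_const]
    refine integral_congr_ae (.of_forall fun t => ?_)
    simp only [F, Matrix.smul_apply, Matrix.mul_diagonal, Matrix.diagonal_mul, smul_eq_mul]
    rw [show ((s - (l i - l j) : ℝ) : ℂ) * t * Complex.I = (s * t : ℝ) * Complex.I +
      ((-(l i * t) : ℝ) * Complex.I + (l j * t : ℝ) * Complex.I) by push_cast; ring,
      Complex.exp_add, Complex.exp_add]
    ring
  rw [hF]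
  simpa using norm_integral_le_of_norm_le_const (μ := P) (.of_forall hnorm)

/-- The Gaussian case of `norm_charFun_schur_le`. -/
theorem norm_gaussian_schur_le {m : Type*} [Fintype m] [DecidableEq m] {σ : ℝ}
    (l : m → ℝ) (s : ℝ) (N : Matrix m m ℂ) :
    ‖Matrix.of fun i j => (Real.exp (-(s - (l i - l j)) ^ 2 / (4 * σ ^ 2)) : ℂ) * N i j‖
      ≤ ‖N‖ := by
  convert norm_charFun_schur_le
    (ProbabilityTheory.gaussianReal 0 (Real.toNNReal (1 / (2 * σ ^ 2)))) l s N using 5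
  rw [ProbabilityTheory.charFun_gaussianReal, Real.coe_toNNReal _ (by positivity)]
  push_cast
  ring_nf

theorem eigenspaceProj_eq {n : ℕ} {H : Matrix (Fin n) (Fin n) ℂ} (hH : H.IsHermitian) (E : ℝ) :
    eigenspaceProj hH E = (hH.eigenvectorUnitary : Matrix (Fin n) (Fin n) ℂ) *
      diagonal (fun i => if hH.eigenvalues i = E then 1 else 0) *
        star (hH.eigenvectorUnitary : Matrix (Fin n) (Fin n) ℂ) := by
  rw [eigenspaceProj, ← Finset.sum_mul, ← Finset.mul_sum]
  congr 2
  ext i j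
  rw [Matrix.sum_apply, Finset.sum_filter, Finset.sum_eq_single i]
  · simp only [Matrix.single_apply, Matrix.diagonal_apply, true_and]
    split_ifs <;> rfl
  · intro k _ hk
    simp [hk]
  · simp

theorem oft_eq_sum {n : ℕ} {H : Matrix (Fin n) (Fin n) ℂ} (hH : H.IsHermitian)
    (A : Matrix (Fin n) (Fin n) ℂ) (σ ω : ℝ) :
    oft hH A σ ω = ∑ p ∈ eigenvalueSet hH ×ˢ eigenvalueSet hH,
      (gaussianWeight σ (ω - (p.2 - p.1)) : ℂ) •
        (eigenspaceProj hH p.2 * A * eigenspaceProj hH p.1) := by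
  rw [oft, ← Finset.sum_fiberwise_of_maps_to (t := bohrSet hH) (g := fun p : ℝ × ℝ => p.2 - p.1)
    (fun p hp => Finset.mem_image_of_mem (fun p : ℝ × ℝ => p.2 - p.1) hp)]
  refine Finset.sum_congr rfl fun ν _ => ?_
  rw [bohrComponent, Finset.smul_sum]
  refine Finset.sum_congr rfl fun p hp => ?_
  rw [(Finset.mem_filter.1 hp).2]

/-- In an eigenbasis of `H`, the operator Fourier transform multiplies the `(i, j)` entry by the
Gaussian weight centred at the Bohr frequency `λ i - λ j`. -/
theorem oft_eq_conj {n : ℕ} {H : Matrix (Fin n) (Fin n) ℂ} (hH : H.IsHermitian)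
    (A : Matrix (Fin n) (Fin n) ℂ) (σ ω : ℝ) :
    oft hH A σ ω = (hH.eigenvectorUnitary : Matrix (Fin n) (Fin n) ℂ) *
      (Matrix.of fun i j =>
        (gaussianWeight σ (ω - (hH.eigenvalues i - hH.eigenvalues j)) : ℂ) *
          (star (hH.eigenvectorUnitary : Matrix (Fin n) (Fin n) ℂ) * A *
            (hH.eigenvectorUnitary : Matrix (Fin n) (Fin n) ℂ)) i j) *
        star (hH.eigenvectorUnitary : Matrix (Fin n) (Fin n) ℂ) := by
  rw [oft_eq_sum]
  simp_rw [eigenspaceProj_eq]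
  set U := (hH.eigenvectorUnitary : Matrix (Fin n) (Fin n) ℂ)
  set A' := star U * A * U with hA'
  have hterm : ∀ (c : ℂ) (D D' : Matrix (Fin n) (Fin n) ℂ),
      c • (U * D * star U * A * (U * D' * star U)) = U * (c • (D * A' * D')) * star U := by
    intro c D D'
    simp only [hA', Matrix.mul_assoc, Matrix.smul_mul, Matrix.mul_smul]
  simp only [hterm]
  rw [← Finset.sum_mul, ← Finset.mul_sum]
  congr 2
  ext i j
  have hmem : (hH.eigenvalues j, hH.eigenvalues i) ∈ eigenvalueSet hH ×ˢ eigenvalueSet hH := by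
    simp [eigenvalueSet]
  rw [Matrix.sum_apply, Finset.sum_eq_single_of_mem _ hmem]
  · simp
  · rintro ⟨E, E'⟩ - hne
    by_cases hi : hH.eigenvalues i = E'
    · have hj : hH.eigenvalues j ≠ E := fun hj => hne (by rw [hi, hj])
      simp [hj]
    · simp [hi]

theorem exp_smul_eq_conj {n : ℕ} {H : Matrix (Fin n) (Fin n) ℂ} (hH : H.IsHermitian) (c : ℂ) :
    NormedSpace.exp (c • H) = (hH.eigenvectorUnitary : Matrix (Fin n) (Fin n) ℂ) *
      diagonal (fun i => Complex.exp (c * hH.eigenvalues i)) *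
        star (hH.eigenvectorUnitary : Matrix (Fin n) (Fin n) ℂ) := by
  set U := (hH.eigenvectorUnitary : Matrix (Fin n) (Fin n) ℂ)
  have hU : U * star U = 1 := Unitary.coe_mul_star_self hH.eigenvectorUnitary
  have hinv : U⁻¹ = star U := Matrix.inv_eq_right_inv hU
  have hunit : IsUnit U := IsUnit.of_mul_eq_one _ hU
  have hH' : c • H = U * diagonal (fun i => c * (hH.eigenvalues i : ℂ)) * U⁻¹ := by
    conv_lhs => rw [hH.spectral_theorem, Unitary.conjStarAlgAut_apply]
    rw [hinv, ← Matrix.smul_mul, ← Matrix.mul_smul, ← Matrix.diagonal_smul]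
    rfl
  rw [hH', Matrix.exp_conj _ _ hunit, Matrix.exp_diagonal, hinv]
  congr 3
  ext i
  rw [Pi.coe_exp, Complex.exp_eq_exp_ℂ]

/-- Norm decay of the operator Fourier transform for large energy differences:
`‖Â(ω)‖ ≤ (e^{−βω+σ²β²}/√(σ√(2π))) ‖e^{βH} A e^{−βH}‖` in the spectral norm. -/
theorem norm_oft_le {n : ℕ} {H : Matrix (Fin n) (Fin n) ℂ} (hH : H.IsHermitian)
    (A : Matrix (Fin n) (Fin n) ℂ) (σ : ℝ) (hσ : 0 < σ) (β ω : ℝ) :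
    ‖oft hH A σ ω‖ ≤
      Real.exp (-β * ω + σ ^ 2 * β ^ 2) / Real.sqrt (σ * Real.sqrt (2 * Real.pi)) *
        ‖NormedSpace.exp ((β : ℂ) • H) * A * NormedSpace.exp (-(β : ℂ) • H)‖ := by
  set U := (hH.eigenvectorUnitary : Matrix (Fin n) (Fin n) ℂ) with hUdef
  set l := hH.eigenvalues
  have hnorm : ∀ X : Matrix (Fin n) (Fin n) ℂ, ‖U * X * star U‖ = ‖X‖ := fun X => by
    rw [hUdef, ← Unitary.coe_star, CStarRing.norm_mul_coe_unitary,
      CStarRing.norm_coe_unitary_mul]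
  set N : Matrix (Fin n) (Fin n) ℂ :=
    diagonal (fun i => Complex.exp (β * l i)) * (star U * A * U) *
      diagonal (fun i => Complex.exp (-β * l i)) with hN
  have hB : NormedSpace.exp ((β : ℂ) • H) * A * NormedSpace.exp (-(β : ℂ) • H) =
      U * N * star U := by
    rw [exp_smul_eq_conj hH, exp_smul_eq_conj hH, hN]
    simp only [Matrix.mul_assoc]
    rfl
  rw [hB, oft_eq_conj, hnorm, hnorm]
  have hweight : (Matrix.of fun i j =>
      (gaussianWeight σ (ω - (l i - l j)) : ℂ) * (star U * A * U) i j) =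
      ((Real.exp (-β * ω + σ ^ 2 * β ^ 2) / Real.sqrt (σ * Real.sqrt (2 * Real.pi)) : ℝ) : ℂ) •
        Matrix.of fun i j => (Real.exp
          (-(ω - 2 * σ ^ 2 * β - (l i - l j)) ^ 2 / (4 * σ ^ 2)) : ℂ) * N i j := by
    ext i j
    simp only [Matrix.smul_apply, Matrix.of_apply, hN, Matrix.mul_diagonal, Matrix.diagonal_mul,
      smul_eq_mul]
    have hexp : Real.exp (-(ω - (l i - l j)) ^ 2 / (4 * σ ^ 2)) =
        Real.exp (-β * ω + σ ^ 2 * β ^ 2) *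
          Real.exp (-(ω - 2 * σ ^ 2 * β - (l i - l j)) ^ 2 / (4 * σ ^ 2)) *
            (Real.exp (β * l i) * Real.exp (-β * l j)) := by
      simp only [← Real.exp_add]
      congr 1
      field_simp
      ring
    rw [gaussianWeight, hexp]
    push_cast
    ring
  rw [hweight, norm_smul, Complex.norm_real, Real.norm_of_nonneg (by positivity)]
  gcongr
  exact norm_gaussian_schur_le l _ N
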